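/- arXiv:2301.10743 — 4 statements merged into one kernel-verified Lean document; each statement's English description precedes it below -/
import Mathlib

section
/- Every formula φ of FOC[+;MOD] is equivalent (i.e., has the same truth value in every finite string over Σ under every assignment of its free variables) to a formula of the form ∃x_1. … ∃x_k. (⋀_{i=1}^k ∃^{=x_i} p. ψ_i ∧ χ), where each ψ_i is quantifier-free with no free count variables (its only free variable is the position variable p), and χ is quantifier-free. -/
namespace FOC

/-- Count terms: affine combinations `c₀ + c₁·x₁ + ⋯ + cₖ·xₖ` with rational
coefficients over count variables (named by naturals). -/
structure CTerm where
  const : ℚ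
  coeffs : List (ℚ × ℕ)

/-- Evaluate a count term under a count-variable assignment. -/
def CTerm.eval (t : CTerm) (ν : ℕ → ℚ) : ℚ :=
  t.const + (t.coeffs.map fun c => c.1 * ν c.2).sum

/-- The count variables occurring in a count term. -/
def CTerm.vars (t : CTerm) : Finset ℕ :=
  (t.coeffs.map Prod.snd).toFinset

/-- The count term consisting of a single variable. -/
def CTerm.var (x : ℕ) : CTerm := ⟨0, [(1, x)]⟩

/-- A constant count term. -/
def CTerm.cst (c : ℚ) : CTerm := ⟨c, []⟩

/-- Formulas of FOC[+;MOD] over the alphabet `A`.  Position variables and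
count variables are both named by naturals (the two sorts are separate). -/
inductive Formula (A : Type) : Type
  | tru : Formula A
  | fls : Formula A
  | qa (a : A) (p : ℕ) : Formula A
  | mod (r m : ℕ) (p : ℕ) : Formula A
  | eq (t₁ t₂ : CTerm) : Formula A
  | lt (t₁ t₂ : CTerm) : Formula A
  | and (φ ψ : Formula A) : Formula A
  | or (φ ψ : Formula A) : Formula A
  | not (φ : Formula A) : Formula A
  | exC (x : ℕ) (φ : Formula A) : Formula A
  | allC (x : ℕ) (φ : Formula A) : Formula A
  | cnt (x : ℕ) (p : ℕ) (φ : Formula A) : Formula A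

variable {A : Type}

open Classical in
/-- Satisfaction of a formula in a string `w` (positions are `1,…,w.length`;
the letter at position `p` is `w[p-1]`), under a position assignment `ρ` and a
count assignment `ν`.  The counting quantifier `cnt x p φ` holds iff the number
of positions `j ∈ [1, w.length]` satisfying `φ` equals `ν x`. -/
def Sat (w : List A) : (ℕ → ℕ) → (ℕ → ℚ) → Formula A → Prop
  | _, _, .tru => True
  | _, _, .fls => False
  | ρ, _, .qa a p => w[ρ p - 1]? = some a
  | ρ, _, .mod r m p => ρ p % m = r % m
  | _, ν, .eq t₁ t₂ => t₁.eval ν = t₂.eval ν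
  | _, ν, .lt t₁ t₂ => t₁.eval ν < t₂.eval ν
  | ρ, ν, .and φ ψ => Sat w ρ ν φ ∧ Sat w ρ ν ψ
  | ρ, ν, .or φ ψ => Sat w ρ ν φ ∨ Sat w ρ ν ψ
  | ρ, ν, .not φ => ¬ Sat w ρ ν φ
  | ρ, ν, .exC x φ => ∃ q : ℚ, Sat w ρ (Function.update ν x q) φ
  | ρ, ν, .allC x φ => ∀ q : ℚ, Sat w ρ (Function.update ν x q) φ
  | ρ, ν, .cnt x p φ =>
      (((Finset.Icc 1 w.length).filter
          (fun j => Sat w (Function.update ρ p j) ν φ)).card : ℚ) = ν x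

/-- Free position variables of a formula. -/
def freePos : Formula A → Finset ℕ
  | .tru => ∅
  | .fls => ∅
  | .qa _ p => {p}
  | .mod _ _ p => {p}
  | .eq _ _ => ∅
  | .lt _ _ => ∅
  | .and φ ψ => freePos φ ∪ freePos ψ
  | .or φ ψ => freePos φ ∪ freePos ψ
  | .not φ => freePos φ
  | .exC _ φ => freePos φ
  | .allC _ φ => freePos φ
  | .cnt _ p φ => freePos φ \ {p}

/-- Free count variables of a formula. -/
def freeCount : Formula A → Finset ℕ
  | .tru => ∅
  | .fls => ∅
  | .qa _ _ => ∅
  | .mod _ _ _ => ∅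
  | .eq t₁ t₂ => t₁.vars ∪ t₂.vars
  | .lt t₁ t₂ => t₁.vars ∪ t₂.vars
  | .and φ ψ => freeCount φ ∪ freeCount ψ
  | .or φ ψ => freeCount φ ∪ freeCount ψ
  | .not φ => freeCount φ
  | .exC x φ => freeCount φ \ {x}
  | .allC x φ => freeCount φ \ {x}
  | .cnt x _ φ => freeCount φ ∪ {x}

/-- Quantifier-free formulas (no `∃x`, `∀x`, and no counting quantifier). -/
def QFree : Formula A → Prop
  | .and φ ψ => QFree φ ∧ QFree ψ
  | .or φ ψ => QFree φ ∧ QFree ψ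
  | .not φ => QFree φ
  | .exC _ _ => False
  | .allC _ _ => False
  | .cnt _ _ _ => False
  | _ => True

/-- Two formulas are equivalent if they have the same truth value in every
string under every assignment of the (position and count) variables. -/
def FOCEquiv (φ ψ : Formula A) : Prop :=
  ∀ (w : List A) (ρ : ℕ → ℕ) (ν : ℕ → ℚ), Sat w ρ ν φ ↔ Sat w ρ ν ψ

/-- A sentence is a formula without free variables. -/
def IsSentence (φ : Formula A) : Prop := freePos φ = ∅ ∧ freeCount φ = ∅

/-- The language defined by a sentence. -/
def Defines (σ : Formula A) (L : Set (List A)) : Prop :=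
  ∀ w, w ∈ L ↔ Sat w (fun _ => 1) (fun _ => 0) σ

/-- Finite conjunction. -/
def bigAnd (l : List (Formula A)) : Formula A := l.foldr .and .tru

/-- Finite disjunction. -/
def bigOr (l : List (Formula A)) : Formula A := l.foldr .or .fls

/-- Iterated existential count quantification `∃x₁.…∃xₖ. φ`. -/
def exCs (xs : List ℕ) (φ : Formula A) : Formula A := xs.foldr .exC φ

end FOC

namespace FOC

variable {A : Type}

open Classical in
/-- The number of positions of `w` lying in `R`. -/
noncomputable def posCount (w : List A) (R : ℕ → Prop) : ℚ :=
  ((Finset.Icc 1 w.length).filter R).card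

/-- Properties of a single position definable by Boolean combinations of letter and
modular predicates. -/
inductive PosDefinable : (List A → ℕ → Prop) → Prop
  | tru : PosDefinable fun _ _ => True
  | qa (a : A) : PosDefinable fun w j => w[j - 1]? = some a
  | mod (r m : ℕ) : PosDefinable fun _ j => j % m = r % m
  | and {R S : List A → ℕ → Prop} : PosDefinable R → PosDefinable S →
      PosDefinable fun w j => R w j ∧ S w j
  | not {R : List A → ℕ → Prop} : PosDefinable R → PosDefinable fun w j => ¬ R w j

/-- Affine combinations of count variables and of cardinalities of `PosDefinable` sets of
positions. -/
inductive TermDefinable : (List A → (ℕ → ℚ) → ℚ) → Prop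
  | const (c : ℚ) : TermDefinable fun _ _ => c
  | var (x : ℕ) : TermDefinable fun _ ν => ν x
  | count {R : List A → ℕ → Prop} : PosDefinable R → TermDefinable fun w _ => posCount w (R w)
  | add {T U : List A → (ℕ → ℚ) → ℚ} : TermDefinable T → TermDefinable U →
      TermDefinable fun w ν => T w ν + U w ν
  | smul (c : ℚ) {T : List A → (ℕ → ℚ) → ℚ} : TermDefinable T → TermDefinable fun w ν => c * T w ν

/-- Boolean combinations of letter and modular predicates on the free position variables and of
strict inequalities between `TermDefinable` quantities. -/
inductive Definable : (List A → (ℕ → ℕ) → (ℕ → ℚ) → Prop) → Prop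
  | tru : Definable fun _ _ _ => True
  | qa (a : A) (p : ℕ) : Definable fun w ρ _ => w[ρ p - 1]? = some a
  | mod (r m p : ℕ) : Definable fun _ ρ _ => ρ p % m = r % m
  | pos {T : List A → (ℕ → ℚ) → ℚ} : TermDefinable T → Definable fun w _ ν => 0 < T w ν
  | and {P Q : List A → (ℕ → ℕ) → (ℕ → ℚ) → Prop} : Definable P → Definable Q →
      Definable fun w ρ ν => P w ρ ν ∧ Q w ρ ν
  | not {P : List A → (ℕ → ℕ) → (ℕ → ℚ) → Prop} : Definable P → Definable fun w ρ ν => ¬ P w ρ ν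

theorem PosDefinable.fls : PosDefinable fun (_ : List A) _ => False := by
  simpa using PosDefinable.not (PosDefinable.tru (A := A))

theorem Definable.fls : Definable fun (_ : List A) _ _ => False := by
  simpa using Definable.not (Definable.tru (A := A))

theorem Definable.or {P Q : List A → (ℕ → ℕ) → (ℕ → ℚ) → Prop} (hP : Definable P)
    (hQ : Definable Q) : Definable fun w ρ ν => P w ρ ν ∨ Q w ρ ν := by
  have h := (hP.not.and hQ.not).not
  simpa only [not_and_or, not_not] using h

theorem Definable.exists_mem {α : Type*} {P : α → List A → (ℕ → ℕ) → (ℕ → ℚ) → Prop}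
    (l : List α) (h : ∀ a ∈ l, Definable (P a)) :
    Definable fun w ρ ν => ∃ a ∈ l, P a w ρ ν := by
  induction l with
  | nil => simpa using Definable.fls
  | cons a l ih =>
    simp only [List.mem_cons, exists_eq_or_imp]
    exact (h a (by simp)).or (ih fun b hb => h b (by simp [hb]))

theorem TermDefinable.sub {T U : List A → (ℕ → ℚ) → ℚ} (hT : TermDefinable T)
    (hU : TermDefinable U) : TermDefinable fun w ν => T w ν - U w ν := by
  simpa [sub_eq_add_neg] using hT.add (hU.smul (-1))

theorem Definable.lt {T U : List A → (ℕ → ℚ) → ℚ} (hT : TermDefinable T)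
    (hU : TermDefinable U) : Definable fun w _ ν => T w ν < U w ν := by
  simpa using Definable.pos (hU.sub hT)

theorem Definable.eq {T U : List A → (ℕ → ℚ) → ℚ} (hT : TermDefinable T)
    (hU : TermDefinable U) : Definable fun w _ ν => T w ν = U w ν := by
  simpa only [not_lt, ← le_antisymm_iff] using (Definable.lt hU hT).not.and (Definable.lt hT hU).not

theorem TermDefinable.eval (t : CTerm) :
    TermDefinable fun (_ : List A) ν => t.eval ν := by
  obtain ⟨c, l⟩ := t
  simp only [CTerm.eval]
  refine (TermDefinable.const c).add ?_
  induction l with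
  | nil => simpa using TermDefinable.const 0
  | cons d l ih => simpa using ((TermDefinable.var d.2).smul d.1).add ih

theorem TermDefinable.subst (x : ℕ) {T U : List A → (ℕ → ℚ) → ℚ} (hT : TermDefinable T)
    (hU : TermDefinable U) :
    TermDefinable fun w ν => T w (Function.update ν x (U w ν)) := by
  induction hT with
  | const c => exact .const c
  | var y =>
    by_cases h : y = x
    · subst h; simpa using hU
    · simpa [h] using TermDefinable.var y
  | count hR => exact .count hR
  | add _ _ ih₁ ih₂ => exact ih₁.add ih₂
  | smul c _ ih => exact ih.smul c

theorem Definable.subst (x : ℕ) {P : List A → (ℕ → ℕ) → (ℕ → ℚ) → Prop}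
    {U : List A → (ℕ → ℚ) → ℚ} (hP : Definable P) (hU : TermDefinable U) :
    Definable fun w ρ ν => P w ρ (Function.update ν x (U w ν)) := by
  induction hP with
  | tru => exact .tru
  | qa a p => exact .qa a p
  | mod r m p => exact .mod r m p
  | pos hT => exact .pos (hT.subst x hU)
  | and _ _ ih₁ ih₂ => exact ih₁.and ih₂
  | not _ ih => exact ih.not

theorem TermDefinable.exists_slope (x : ℕ) {T : List A → (ℕ → ℚ) → ℚ} (hT : TermDefinable T) :
    ∃ a : ℚ, ∀ w ν q, T w (Function.update ν x q) = a * q + T w (Function.update ν x 0) := by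
  induction hT with
  | const c => exact ⟨0, by simp⟩
  | var y =>
    by_cases h : y = x
    · subst h; exact ⟨1, by simp⟩
    · exact ⟨0, by simp [h]⟩
  | count hR => exact ⟨0, by simp⟩
  | add _ _ ih₁ ih₂ =>
    obtain ⟨a, ha⟩ := ih₁
    obtain ⟨b, hb⟩ := ih₂
    exact ⟨a + b, fun w ν q => by simp only [ha w ν q, hb w ν q]; ring⟩
  | smul c _ ih =>
    obtain ⟨a, ha⟩ := ih
    exact ⟨c * a, fun w ν q => by simp only [ha w ν q]; ring⟩

/-- The truth value of a definable property depends on the value `q` of `x` only through the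
order type of `q` relative to finitely many definable quantities. -/
theorem Definable.exists_breakpoints (x : ℕ) {P : List A → (ℕ → ℕ) → (ℕ → ℚ) → Prop}
    (hP : Definable P) :
    ∃ E : List (List A → (ℕ → ℚ) → ℚ), (∀ e ∈ E, TermDefinable e) ∧
      ∀ w ρ ν q q', (∀ e ∈ E, (q < e w ν ↔ q' < e w ν) ∧ (e w ν < q ↔ e w ν < q')) →
        (P w ρ (Function.update ν x q) ↔ P w ρ (Function.update ν x q')) := by
  induction hP with
  | tru => exact ⟨[], by simp⟩
  | qa a p => exact ⟨[], by simp⟩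
  | mod r m p => exact ⟨[], by simp⟩
  | @pos T hT =>
    obtain ⟨a, ha⟩ := hT.exists_slope x
    refine ⟨[fun w ν => -a⁻¹ * T w (Function.update ν x 0)], ?_, ?_⟩
    · simpa using (hT.subst x (.const 0)).smul (-a⁻¹)
    · intro w ρ ν q q' h
      simp only [List.mem_singleton, forall_eq] at h
      simp only [ha w ν q, ha w ν q']
      generalize T w (Function.update ν x 0) = b at h
      rcases lt_trichotomy a 0 with h0 | rfl | h0
      · have key : ∀ r : ℚ, 0 < a * r + b ↔ r < -a⁻¹ * b := fun r => by
          rw [show -a⁻¹ * b = (-b) / a by ring, lt_div_iff_of_neg h0]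
          constructor <;> intro _ <;> linarith
        rw [key, key, h.1]
      · simp
      · have key : ∀ r : ℚ, 0 < a * r + b ↔ -a⁻¹ * b < r := fun r => by
          rw [show -a⁻¹ * b = (-b) / a by ring, div_lt_iff₀ h0]
          constructor <;> intro _ <;> linarith
        rw [key, key, h.2]
  | and _ _ ih₁ ih₂ =>
    obtain ⟨E, hE, h₁⟩ := ih₁
    obtain ⟨F, hF, h₂⟩ := ih₂
    refine ⟨E ++ F, fun e he => (List.mem_append.1 he).elim (hE e) (hF e), ?_⟩
    intro w ρ ν q q' h
    exact and_congr (h₁ w ρ ν q q' fun e he => h e (List.mem_append_left _ he))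
      (h₂ w ρ ν q q' fun e he => h e (List.mem_append_right _ he))
  | not _ ih =>
    obtain ⟨E, hE, h⟩ := ih
    exact ⟨E, hE, fun w ρ ν q q' hq => not_congr (h w ρ ν q q' hq)⟩

/-- Every rational has the same order type relative to a finite set as some sample point: zero,
the midpoint of two elements, or an element shifted by `±1`. -/
theorem exists_sample_point (E : Finset ℚ) (q : ℚ) :
    ∃ s : ℚ, (s = 0 ∨ ∃ e ∈ E, ∃ f ∈ E, s = 2⁻¹ * (e + f) ∨ s = e + 1 ∨ s = e - 1) ∧
      ∀ e ∈ E, (q < e ↔ s < e) ∧ (e < q ↔ e < s) := by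
  by_cases hq : q ∈ E
  · exact ⟨q, Or.inr ⟨q, hq, q, hq, Or.inl (by ring)⟩, by simp⟩
  have hne : ∀ e ∈ E, e < q ∨ q < e := fun e he =>
    lt_or_gt_of_ne fun h => hq (h ▸ he)
  rcases (E.filter (· < q)).eq_empty_or_nonempty with hL | hL <;>
    rcases (E.filter (q < ·)).eq_empty_or_nonempty with hU | hU
  · refine ⟨0, Or.inl rfl, fun e he => ?_⟩
    have h₁ := Finset.filter_eq_empty_iff.1 hL he
    have h₂ := Finset.filter_eq_empty_iff.1 hU he
    exact ((hne e he).elim h₁ h₂).elim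
  · obtain ⟨u, hu, hmin⟩ := Finset.exists_min_image _ id hU
    rw [Finset.mem_filter] at hu
    refine ⟨u - 1, Or.inr ⟨u, hu.1, u, hu.1, by simp⟩, fun e he => ?_⟩
    have h₁ := Finset.filter_eq_empty_iff.1 hL he
    have h₂ := (hne e he).resolve_left h₁
    have h₃ : u ≤ e := hmin e (Finset.mem_filter.2 ⟨he, h₂⟩)
    constructor <;> constructor <;> intro _ <;> linarith
  · obtain ⟨l, hl, hmax⟩ := Finset.exists_max_image _ id hL
    rw [Finset.mem_filter] at hl
    refine ⟨l + 1, Or.inr ⟨l, hl.1, l, hl.1, by simp⟩, fun e he => ?_⟩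
    have h₁ := Finset.filter_eq_empty_iff.1 hU he
    have h₂ := (hne e he).resolve_right h₁
    have h₃ : e ≤ l := hmax e (Finset.mem_filter.2 ⟨he, h₂⟩)
    constructor <;> constructor <;> intro _ <;> linarith
  · obtain ⟨l, hl, hmax⟩ := Finset.exists_max_image _ id hL
    obtain ⟨u, hu, hmin⟩ := Finset.exists_min_image _ id hU
    rw [Finset.mem_filter] at hl hu
    refine ⟨2⁻¹ * (l + u), Or.inr ⟨l, hl.1, u, hu.1, by simp⟩, fun e he => ?_⟩
    rcases hne e he with h | h
    · have h₃ : e ≤ l := hmax e (Finset.mem_filter.2 ⟨he, h⟩)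
      constructor <;> constructor <;> intro _ <;> linarith
    · have h₃ : u ≤ e := hmin e (Finset.mem_filter.2 ⟨he, h⟩)
      constructor <;> constructor <;> intro _ <;> linarith

/-- Quantifier elimination for count variables. -/
theorem Definable.exists_update (x : ℕ) {P : List A → (ℕ → ℕ) → (ℕ → ℚ) → Prop}
    (hP : Definable P) : Definable fun w ρ ν => ∃ q : ℚ, P w ρ (Function.update ν x q) := by
  obtain ⟨E, hE, h⟩ := hP.exists_breakpoints x
  let D (U : List A → (ℕ → ℚ) → ℚ) : List A → (ℕ → ℕ) → (ℕ → ℚ) → Prop :=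
    fun w ρ ν => P w ρ (Function.update ν x (U w ν))
  have hD : Definable fun w ρ ν => D (fun _ _ => 0) w ρ ν ∨ ∃ e ∈ E, ∃ f ∈ E,
      D (fun w ν => 2⁻¹ * (e w ν + f w ν)) w ρ ν ∨ D (fun w ν => e w ν + 1) w ρ ν ∨
        D (fun w ν => e w ν - 1) w ρ ν :=
    (hP.subst x (.const 0)).or <| .exists_mem E fun e he => .exists_mem E fun f hf =>
      (hP.subst x (((hE e he).add (hE f hf)).smul _)).or <|
        (hP.subst x ((hE e he).add (.const 1))).or (hP.subst x ((hE e he).sub (.const 1)))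
  convert hD using 4 with w ρ ν
  constructor
  · rintro ⟨q, hq⟩
    obtain ⟨s, hs, hqs⟩ := exists_sample_point (E.map fun e => e w ν).toFinset q
    simp only [List.mem_toFinset, List.mem_map, exists_exists_and_eq_and, forall_exists_index,
      and_imp, forall_apply_eq_imp_iff₂] at hs hqs
    rw [h w ρ ν q s hqs] at hq
    rcases hs with rfl | ⟨e, he, f, hf, rfl | rfl | rfl⟩
    · exact Or.inl hq
    · exact Or.inr ⟨e, he, f, hf, Or.inl hq⟩
    · exact Or.inr ⟨e, he, f, hf, Or.inr (Or.inl hq)⟩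
    · exact Or.inr ⟨e, he, f, hf, Or.inr (Or.inr hq)⟩
  · rintro (hq | ⟨e, -, f, -, hq | hq | hq⟩) <;> exact ⟨_, hq⟩

/-- A property `F` of sets of positions that is definable on `PosDefinable` sets is definable on
the sets obtained from a definable property by abstracting a position variable. -/
theorem Definable.abstract (p : ℕ) {P : List A → (ℕ → ℕ) → (ℕ → ℚ) → Prop} (hP : Definable P)
    (F : List A → (ℕ → ℕ) → (ℕ → ℚ) → (ℕ → Prop) → Prop)
    (hF : ∀ R, PosDefinable R → Definable fun w ρ ν => F w ρ ν (R w)) :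
    Definable fun w ρ ν => F w ρ ν fun j => P w (Function.update ρ p j) ν := by
  have hconst : ∀ (F : List A → (ℕ → ℕ) → (ℕ → ℚ) → (ℕ → Prop) → Prop),
      (∀ R, PosDefinable R → Definable fun w ρ ν => F w ρ ν (R w)) →
      ∀ {Q : List A → (ℕ → ℕ) → (ℕ → ℚ) → Prop}, Definable Q →
      Definable fun w ρ ν => F w ρ ν fun _ => Q w ρ ν := by
    intro F hF Q hQ
    convert (hQ.and (hF _ .tru)).or (hQ.not.and (hF _ .fls)) using 4 with w ρ ν
    by_cases h : Q w ρ ν <;> simp [h]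
  induction hP generalizing F with
  | tru => exact hF _ .tru
  | qa a q =>
    by_cases h : q = p
    · subst h; simpa using hF _ (.qa a)
    · simpa [h] using hconst F hF (.qa a q)
  | mod r m q =>
    by_cases h : q = p
    · subst h; simpa using hF _ (.mod r m)
    · simpa [h] using hconst F hF (.mod r m q)
  | pos hT => exact hconst F hF (.pos hT)
  | @and P Q _ _ ih₁ ih₂ =>
    refine ih₁ (fun w ρ ν R => F w ρ ν fun j => R j ∧ Q w (Function.update ρ p j) ν) fun R hR => ?_
    exact ih₂ (fun w ρ ν S => F w ρ ν fun j => R w j ∧ S j) fun S hS => hF _ (hR.and hS)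
  | not _ ih => exact ih (fun w ρ ν R => F w ρ ν fun j => ¬ R j) fun R hR => hF _ hR.not

theorem Definable.sat (φ : Formula A) : Definable fun w ρ ν => Sat w ρ ν φ := by
  induction φ with
  | tru => exact .tru
  | fls => exact .fls
  | qa a p => exact .qa a p
  | mod r m p => exact .mod r m p
  | eq t u => exact .eq (.eval t) (.eval u)
  | lt t u => exact .lt (.eval t) (.eval u)
  | and _ _ ih₁ ih₂ => exact ih₁.and ih₂
  | or _ _ ih₁ ih₂ => exact ih₁.or ih₂
  | not _ ih => exact ih.not
  | exC x _ ih => exact ih.exists_update x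
  | allC x _ ih => simpa [Sat] using (ih.not.exists_update x).not
  | cnt x p _ ih =>
    exact ih.abstract p (fun w _ ν R => posCount w R = ν x) fun R hR => .eq (.count hR) (.var x)

theorem PosDefinable.exists_formula {R : List A → ℕ → Prop} (hR : PosDefinable R) :
    ∃ ψ : Formula A, (QFree ψ ∧ freeCount ψ = ∅ ∧ freePos ψ ⊆ {0}) ∧
      ∀ w ρ ν, Sat w ρ ν ψ ↔ R w (ρ 0) := by
  induction hR with
  | tru => exact ⟨.tru, by simp [QFree, freeCount, freePos], by simp [Sat]⟩
  | qa a => exact ⟨.qa a 0, by simp [QFree, freeCount, freePos], by simp [Sat]⟩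
  | mod r m => exact ⟨.mod r m 0, by simp [QFree, freeCount, freePos], by simp [Sat]⟩
  | and _ _ ih₁ ih₂ =>
    obtain ⟨ψ₁, ⟨hq₁, hc₁, hp₁⟩, h₁⟩ := ih₁
    obtain ⟨ψ₂, ⟨hq₂, hc₂, hp₂⟩, h₂⟩ := ih₂
    exact ⟨.and ψ₁ ψ₂, ⟨⟨hq₁, hq₂⟩, by simp [freeCount, hc₁, hc₂], Finset.union_subset hp₁ hp₂⟩,
      fun w ρ ν => and_congr (h₁ w ρ ν) (h₂ w ρ ν)⟩
  | not _ ih =>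
    obtain ⟨ψ, hψ, h⟩ := ih
    exact ⟨.not ψ, hψ, fun w ρ ν => not_congr (h w ρ ν)⟩

/-- The assignment `μ` agrees with `ν` below `N` and stores the cardinality of each set of
positions from `L` in the variable which `f` assigns to it. -/
def Stores (L : List (List A → ℕ → Prop)) (N : ℕ) (f : (List A → ℕ → Prop) → ℕ)
    (w : List A) (ν μ : ℕ → ℚ) : Prop :=
  (∀ y < N, μ y = ν y) ∧ ∀ R ∈ L, μ (f R) = posCount w (R w)

theorem Stores.left {L L' : List (List A → ℕ → Prop)} {N N' : ℕ} {f : (List A → ℕ → Prop) → ℕ}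
    {w : List A} {ν μ : ℕ → ℚ} (h : Stores (L ++ L') (max N N') f w ν μ) : Stores L N f w ν μ :=
  ⟨fun y hy => h.1 y (lt_max_of_lt_left hy), fun R hR => h.2 R (List.mem_append_left _ hR)⟩

theorem Stores.right {L L' : List (List A → ℕ → Prop)} {N N' : ℕ} {f : (List A → ℕ → Prop) → ℕ}
    {w : List A} {ν μ : ℕ → ℚ} (h : Stores (L ++ L') (max N N') f w ν μ) : Stores L' N' f w ν μ :=
  ⟨fun y hy => h.1 y (lt_max_of_lt_right hy), fun R hR => h.2 R (List.mem_append_right _ hR)⟩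

theorem TermDefinable.exists_cTerm {T : List A → (ℕ → ℚ) → ℚ} (hT : TermDefinable T) :
    ∃ (L : List (List A → ℕ → Prop)) (N : ℕ), (∀ R ∈ L, PosDefinable R) ∧
      ∀ f, ∃ t : CTerm, ∀ w ν μ, Stores L N f w ν μ → t.eval μ = T w ν := by
  induction hT with
  | const c => exact ⟨[], 0, by simp, fun f => ⟨.cst c, by simp [CTerm.eval, CTerm.cst]⟩⟩
  | var x =>
    refine ⟨[], x + 1, by simp, fun f => ⟨.var x, fun w ν μ h => ?_⟩⟩
    simpa [CTerm.eval, CTerm.var] using h.1 x (Nat.lt_succ_self x)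
  | @count R hR =>
    refine ⟨[R], 0, by simpa using hR, fun f => ⟨.var (f R), fun w ν μ h => ?_⟩⟩
    simpa [CTerm.eval, CTerm.var] using h.2 R (by simp)
  | add _ _ ih₁ ih₂ =>
    obtain ⟨L₁, N₁, hL₁, h₁⟩ := ih₁
    obtain ⟨L₂, N₂, hL₂, h₂⟩ := ih₂
    refine ⟨L₁ ++ L₂, max N₁ N₂, fun R hR => (List.mem_append.1 hR).elim (hL₁ R) (hL₂ R),
      fun f => ?_⟩
    obtain ⟨t₁, ht₁⟩ := h₁ f
    obtain ⟨t₂, ht₂⟩ := h₂ f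
    refine ⟨⟨t₁.const + t₂.const, t₁.coeffs ++ t₂.coeffs⟩, fun w ν μ h => ?_⟩
    simp only [← ht₁ w ν μ h.left, ← ht₂ w ν μ h.right, CTerm.eval, List.map_append, List.sum_append]
    ring
  | smul c _ ih =>
    obtain ⟨L, N, hL, h⟩ := ih
    refine ⟨L, N, hL, fun f => ?_⟩
    obtain ⟨t, ht⟩ := h f
    refine ⟨⟨c * t.const, t.coeffs.map fun d => (c * d.1, d.2)⟩, fun w ν μ h => ?_⟩
    simp [← ht w ν μ h, CTerm.eval, mul_add, mul_assoc, Function.comp_def, List.sum_map_mul_left]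

theorem Definable.exists_qfree {P : List A → (ℕ → ℕ) → (ℕ → ℚ) → Prop} (hP : Definable P) :
    ∃ (L : List (List A → ℕ → Prop)) (N : ℕ), (∀ R ∈ L, PosDefinable R) ∧
      ∀ f, ∃ χ : Formula A, QFree χ ∧
        ∀ w ρ ν μ, Stores L N f w ν μ → (Sat w ρ μ χ ↔ P w ρ ν) := by
  induction hP with
  | tru => exact ⟨[], 0, by simp, fun f => ⟨.tru, trivial, by simp [Sat]⟩⟩
  | qa a p => exact ⟨[], 0, by simp, fun f => ⟨.qa a p, trivial, by simp [Sat]⟩⟩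
  | mod r m p => exact ⟨[], 0, by simp, fun f => ⟨.mod r m p, trivial, by simp [Sat]⟩⟩
  | pos hT =>
    obtain ⟨L, N, hL, h⟩ := hT.exists_cTerm
    refine ⟨L, N, hL, fun f => ?_⟩
    obtain ⟨t, ht⟩ := h f
    refine ⟨.lt (.cst 0) t, trivial, fun w ρ ν μ h => ?_⟩
    simp [← ht w ν μ h, Sat, CTerm.cst, CTerm.eval]
  | and _ _ ih₁ ih₂ =>
    obtain ⟨L₁, N₁, hL₁, h₁⟩ := ih₁
    obtain ⟨L₂, N₂, hL₂, h₂⟩ := ih₂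
    refine ⟨L₁ ++ L₂, max N₁ N₂, fun R hR => (List.mem_append.1 hR).elim (hL₁ R) (hL₂ R),
      fun f => ?_⟩
    obtain ⟨χ₁, hq₁, hχ₁⟩ := h₁ f
    obtain ⟨χ₂, hq₂, hχ₂⟩ := h₂ f
    exact ⟨.and χ₁ χ₂, ⟨hq₁, hq₂⟩, fun w ρ ν μ h =>
      and_congr (hχ₁ w ρ ν μ h.left) (hχ₂ w ρ ν μ h.right)⟩
  | not _ ih =>
    obtain ⟨L, N, hL, h⟩ := ih
    refine ⟨L, N, hL, fun f => ?_⟩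
    obtain ⟨χ, hq, hχ⟩ := h f
    exact ⟨.not χ, hq, fun w ρ ν μ h => not_congr (hχ w ρ ν μ h)⟩

theorem sat_bigAnd (w : List A) (ρ : ℕ → ℕ) (ν : ℕ → ℚ) (l : List (Formula A)) :
    Sat w ρ ν (bigAnd l) ↔ ∀ φ ∈ l, Sat w ρ ν φ := by
  induction l with
  | nil => simp [bigAnd, Sat]
  | cons φ l ih => simpa [bigAnd, Sat] using fun _ => ih

theorem sat_exCs (w : List A) (ρ : ℕ → ℕ) (ν : ℕ → ℚ) (xs : List ℕ) (φ : Formula A) :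
    Sat w ρ ν (exCs xs φ) ↔ ∃ μ : ℕ → ℚ, (∀ y ∉ xs, μ y = ν y) ∧ Sat w ρ μ φ := by
  induction xs generalizing ν with
  | nil =>
    refine ⟨fun h => ⟨ν, fun _ _ => rfl, h⟩, ?_⟩
    rintro ⟨μ, hμ, h⟩
    rwa [funext fun y => hμ y List.not_mem_nil] at h
  | cons x xs ih =>
    change (∃ q, Sat w ρ (Function.update ν x q) (exCs xs φ)) ↔ _
    simp only [ih]
    constructor
    · rintro ⟨q, μ, hμ, h⟩
      refine ⟨μ, fun y hy => ?_, h⟩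
      rw [List.mem_cons, not_or] at hy
      rw [hμ y hy.2, Function.update_of_ne hy.1]
    · rintro ⟨μ, hμ, h⟩
      refine ⟨μ x, μ, fun y hy => ?_, h⟩
      by_cases hyx : y = x
      · subst hyx; simp
      · rw [Function.update_of_ne hyx, hμ y (by simp [hyx, hy])]

end FOC

open FOC

/-- **Normal form (Theorem 1).** Every formula of FOC[+;MOD] is equivalent to
one of the form `∃x₁.…∃xₖ.(⋀ᵢ ∃^{=xᵢ}p. ψᵢ ∧ χ)`, where each `ψᵢ` is
quantifier-free with no free count variables (its only free variable is the
position variable `p`), and `χ` is quantifier-free. -/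
theorem foc_normal_form {A : Type} [Fintype A] (φ : FOC.Formula A) :
    ∃ (k : ℕ) (xs : Fin k → ℕ) (pv : ℕ) (ψ : Fin k → FOC.Formula A)
      (χ : FOC.Formula A),
      (∀ i, FOC.QFree (ψ i) ∧ FOC.freeCount (ψ i) = ∅ ∧ FOC.freePos (ψ i) ⊆ {pv}) ∧
      FOC.QFree χ ∧
      FOC.FOCEquiv φ
        (FOC.exCs (List.ofFn xs)
          (FOC.Formula.and
            (FOC.bigAnd (List.ofFn fun i => FOC.Formula.cnt (xs i) pv (ψ i))) χ)) := by
  classical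
  obtain ⟨L, N, hL, h⟩ := (Definable.sat φ).exists_qfree
  obtain ⟨χ, hχ, hsat⟩ := h fun R => N + L.idxOf R
  choose ψ hψ hψsat using fun i : Fin L.length => (hL (L.get i) (L.get_mem i)).exists_formula
  have hcnt : ∀ w ρ (μ : ℕ → ℚ) (i : Fin L.length),
      Sat w ρ μ (.cnt (N + i) 0 (ψ i)) ↔ posCount w (L.get i w) = μ (N + i) := by
    intro w ρ μ i
    simp [Sat, posCount, hψsat]
  refine ⟨L.length, fun i => N + i, 0, ψ, χ, hψ, hχ, fun w ρ ν => ?_⟩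
  have hbody : ∀ μ, Sat w ρ μ (.and (bigAnd (List.ofFn fun i => .cnt (N + i) 0 (ψ i))) χ) ↔
      (∀ i : Fin L.length, posCount w (L.get i w) = μ (N + i)) ∧ Sat w ρ μ χ := fun μ => by
    refine and_congr ?_ Iff.rfl
    simp only [sat_bigAnd, List.mem_ofFn, forall_exists_index, forall_apply_eq_imp_iff, hcnt]
  simp only [sat_exCs, hbody, List.mem_ofFn]
  constructor
  · intro hφ
    let μ : ℕ → ℚ := fun y =>
      if hy : N ≤ y ∧ y - N < L.length then posCount w (L.get ⟨y - N, hy.2⟩ w) else ν y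
    have hμ : ∀ i : Fin L.length, posCount w (L.get i w) = μ (N + i) := fun i => by
      have hi : N ≤ N + (i : ℕ) ∧ N + (i : ℕ) - N < L.length := by omega
      rw [show μ (N + i) = _ from dif_pos hi]
      congr 2
      simp
    refine ⟨μ, fun y hy => dif_neg fun hy' => hy ⟨⟨y - N, hy'.2⟩, by simp [hy'.1]⟩, hμ,
      (hsat w ρ ν μ ⟨fun y hy => dif_neg fun hy' => by omega, fun R hR => ?_⟩).2 hφ⟩
    simpa using (hμ ⟨L.idxOf R, List.idxOf_lt_length_of_mem hR⟩).symm
  · rintro ⟨μ, hμ, hc, hs⟩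
    refine (hsat w ρ ν μ ⟨fun y hy => hμ y ?_, fun R hR => ?_⟩).1 hs
    · rintro ⟨i, rfl⟩
      omega
    · simpa using (hc ⟨L.idxOf R, List.idxOf_lt_length_of_mem hR⟩).symm
end

section
/- The language (01)* over the alphabet Σ = {0,1} is definable by a sentence of FOC[+;MOD], but there is no simplified stateless k-counter machine (for any k) that recognizes it. -/
/-- A simplified stateless `k`-counter machine: an alphabet `A`, a counter
update function `u`, and an acceptance mask `F`. -/
structure SSCM (A : Type) where
  k : ℕ
  u : A → Fin k → ℤ
  F : Fin k → Bool

/-- `M` accepts `w` iff, with final counter value `c = Σᵢ u(wᵢ)`, each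
coordinate satisfies `cᵢ = 0` exactly when `Fᵢ = 0` (false). -/
def SSCM.accepts {A : Type} (M : SSCM A) (w : List A) : Prop :=
  ∀ i : Fin M.k, ((w.map M.u).sum i = 0 ↔ M.F i = false)

/-- The language `(01)*` over `{0,1}` (with `0 = false`, `1 = true`):
even length, `0` at odd (1-based) positions and `1` at even positions. -/
def L01star : Set (List Bool) :=
  {w | w.length % 2 = 0 ∧ ∀ (i : ℕ) (h : i < w.length), w[i] = decide (i % 2 = 1)}

theorem card_filter_odd_Icc (n : ℕ) :
    ((Finset.Icc 1 n).filter (fun j => j % 2 = 1)).card = (n + 1) / 2 := by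
  induction n with
  | zero => rfl
  | succ n ih =>
    rw [← Finset.insert_Icc_right_eq_Icc_add_one (by omega), Finset.filter_insert]
    split_ifs <;> simp_all <;> omega

theorem card_filter_even_Icc (n : ℕ) :
    ((Finset.Icc 1 n).filter (fun j => j % 2 = 0)).card = n / 2 := by
  induction n with
  | zero => rfl
  | succ n ih =>
    rw [← Finset.insert_Icc_right_eq_Icc_add_one (by omega), Finset.filter_insert]
    split_ifs <;> simp_all <;> omega

/-- The letter at position `p` is `0` if `p` is odd, and `1` if `p` is even. -/
def alternatesAt (p : ℕ) : FOC.Formula Bool :=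
  .or (.and (.qa false p) (.mod 1 2 p)) (.and (.qa true p) (.mod 0 2 p))

/-- No position violates the alternation, and there are as many odd positions
as even ones. -/
def sentence01star : FOC.Formula Bool :=
  .and
    (.exC 0 (.and (.eq (.var 0) (.cst 0)) (.cnt 0 0 (.not (alternatesAt 0)))))
    (.exC 0 (.and (.cnt 0 0 (.mod 1 2 0)) (.cnt 0 0 (.mod 0 2 0))))

theorem isSentence_sentence01star : FOC.IsSentence sentence01star := by
  constructor <;> decide

theorem sat_alternatesAt (w : List Bool) (ρ : ℕ → ℕ) (ν : ℕ → ℚ) (p : ℕ) :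
    FOC.Sat w ρ ν (alternatesAt p) ↔ w[ρ p - 1]? = some (decide (ρ p % 2 = 0)) := by
  rcases Nat.mod_two_eq_zero_or_one (ρ p) with h | h <;> simp [alternatesAt, FOC.Sat, h]

theorem sat_sentence01star (w : List Bool) (ρ : ℕ → ℕ) (ν : ℕ → ℚ) :
    FOC.Sat w ρ ν sentence01star ↔
      (∀ j ∈ Finset.Icc 1 w.length, w[j - 1]? = some (decide (j % 2 = 0))) ∧
        w.length / 2 = (w.length + 1) / 2 := by
  simp only [sentence01star, FOC.Sat, sat_alternatesAt, FOC.CTerm.eval, FOC.CTerm.var,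
    FOC.CTerm.cst, Function.update_self, Nat.one_mod, Nat.zero_mod]
  refine and_congr ?_ ?_
  · simp [Finset.filter_eq_empty_iff]
  · simp only [card_filter_odd_Icc, card_filter_even_Icc, exists_eq_left', Nat.cast_inj]

theorem defines_sentence01star : FOC.Defines sentence01star L01star := by
  intro w
  rw [sat_sentence01star]
  refine (and_congr (by omega) ?_).trans and_comm
  constructor
  · intro h j hj
    obtain ⟨h1, h2⟩ := Finset.mem_Icc.mp hj
    rw [List.getElem?_eq_getElem (by omega), h (j - 1) (by omega)]
    congr 2
    simp only [eq_iff_iff]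
    omega
  · intro h i hi
    have := h (i + 1) (Finset.mem_Icc.mpr ⟨by omega, by omega⟩)
    rw [Nat.add_sub_cancel, List.getElem?_eq_getElem hi, Option.some_inj] at this
    rw [this]
    congr 1
    simp only [eq_iff_iff]
    omega

theorem SSCM.accepts_iff_of_perm {A : Type} (M : SSCM A) {v w : List A} (h : v.Perm w) :
    M.accepts v ↔ M.accepts w := by
  simp only [SSCM.accepts, (h.map M.u).sum_eq]

/-- **Proposition 10.** `(01)*` is definable in FOC[+;MOD] but is not
recognized by any simplified stateless counter machine. -/
theorem zo_star_foc_not_sscm :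
    (∃ σ : FOC.Formula Bool, FOC.IsSentence σ ∧ FOC.Defines σ L01star) ∧
    ¬ ∃ M : SSCM Bool, ∀ w, M.accepts w ↔ w ∈ L01star := by
  refine ⟨⟨sentence01star, isSentence_sentence01star, defines_sentence01star⟩, ?_⟩
  rintro ⟨M, hM⟩
  have h01 : [false, true] ∈ L01star := by
    refine ⟨rfl, fun i hi => ?_⟩
    simp only [List.length_cons, List.length_nil] at hi
    interval_cases i <;> rfl
  have h10 : [true, false] ∈ L01star :=
    (hM _).mp ((M.accepts_iff_of_perm (List.Perm.swap _ _ _)).mp ((hM _).mpr h01))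
  exact absurd (h10.2 0 (by simp)) (by simp)
end

section
/- The class of languages definable in FOC[+;MOD] is incomparable with the class of regular languages: the language MAJORITY = {w ∈ {0,1}* | w contains strictly more 1's than 0's} is definable by a sentence of FOC[+;MOD] but is not regular, while the language 0*1* is regular but is not definable by any sentence of FOC[+;MOD]. -/
/-- `MAJORITY`: binary strings with strictly more 1's than 0's
(`0 = false`, `1 = true`). -/
def Maj : Set (List Bool) := {w | w.count false < w.count true}

/-- The language `0*1*`. -/
def LzsOs : Set (List Bool) :=
  {w | ∃ m n : ℕ, w = List.replicate m false ++ List.replicate n true}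

/-- A language is regular if it is recognized by some DFA with finitely many
states. -/
def IsRegularLang (L : Set (List Bool)) : Prop :=
  ∃ (Q : Type) (_ : Fintype Q) (M : DFA Bool Q), ∀ w, w ∈ M.accepts ↔ w ∈ L

namespace FOC

variable {A : Type}

/-- Satisfaction of `φ` is preserved by transposing two positions of the string that lie beyond
`K` and are congruent modulo `K`. -/
def SwapInvariant (K : ℕ) (φ : Formula A) : Prop :=
  ∀ (w w' : List A) (a b : ℕ), K < a → K < b → a ≡ b [MOD K] → a ≤ w.length → b ≤ w.length →
    w'.length = w.length → (∀ j, w'[Equiv.swap a b j - 1]? = w[j - 1]?) →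
    ∀ (ρ : ℕ → ℕ) (ν : ℕ → ℚ), Sat w' (Equiv.swap a b ∘ ρ) ν φ ↔ Sat w ρ ν φ

lemma SwapInvariant.of_dvd {K L : ℕ} {φ : Formula A} (h : SwapInvariant K φ) (hL : 0 < L)
    (hKL : K ∣ L) : SwapInvariant L φ := by
  intro w w' a b ha hb hab
  have hle := Nat.le_of_dvd hL hKL
  exact h w w' a b (by omega) (by omega) (hab.of_dvd hKL)

lemma exists_swapInvariant₂ {φ ψ : Formula A} (hφ : ∃ K, 0 < K ∧ SwapInvariant K φ)
    (hψ : ∃ K, 0 < K ∧ SwapInvariant K ψ) :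
    ∃ K, 0 < K ∧ SwapInvariant K φ ∧ SwapInvariant K ψ := by
  obtain ⟨K, hK, hφ⟩ := hφ
  obtain ⟨L, hL, hψ⟩ := hψ
  have hKL := Nat.mul_pos hK hL
  exact ⟨K * L, hKL, hφ.of_dvd hKL (Nat.dvd_mul_right K L),
    hψ.of_dvd hKL (Nat.dvd_mul_left L K)⟩

lemma swap_swap_apply (a b j : ℕ) : Equiv.swap a b (Equiv.swap a b j) = j :=
  (Equiv.swap a b).left_inv j

lemma swap_modEq {m a b : ℕ} (h : a ≡ b [MOD m]) (j : ℕ) : Equiv.swap a b j ≡ j [MOD m] := by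
  rw [Equiv.swap_apply_def]
  split_ifs with h₁ h₂
  · exact h₁ ▸ h.symm
  · exact h₂ ▸ h
  · rfl

lemma swapInvariant_mod (r m p : ℕ) :
    ∃ K, 0 < K ∧ SwapInvariant K (.mod r m p : Formula A) := by
  rcases Nat.eq_zero_or_pos m with rfl | hm
  · refine ⟨r + 1, by omega, fun w w' a b ha hb _ _ _ _ _ ρ ν => ?_⟩
    simp only [Sat, Function.comp_apply, Nat.mod_zero, Equiv.swap_apply_def]
    split_ifs <;> omega
  · refine ⟨m, hm, fun w w' a b _ _ hab _ _ _ _ ρ ν => ?_⟩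
    have h : Equiv.swap a b (ρ p) % m = ρ p % m := swap_modEq hab (ρ p)
    simp only [Sat, Function.comp_apply, h]

lemma SwapInvariant.cnt {K : ℕ} {φ : Formula A} (h : SwapInvariant K φ) (x p : ℕ) :
    SwapInvariant K (.cnt x p φ) := by
  intro w w' a b ha hb hab haw hbw hlen hw ρ ν
  have hmem (j : ℕ) (hj : j ∈ Finset.Icc 1 w.length) :
      Equiv.swap a b j ∈ Finset.Icc 1 w.length := by
    rw [Finset.mem_Icc] at hj ⊢
    rw [Equiv.swap_apply_def]
    split_ifs <;> omega
  have hsat (j : ℕ) : Sat w' (Function.update (Equiv.swap a b ∘ ρ) p (Equiv.swap a b j)) ν φ ↔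
      Sat w (Function.update ρ p j) ν φ := by
    rw [← Function.comp_update]
    exact h w w' a b ha hb hab haw hbw hlen hw _ ν
  simp only [Sat, hlen]
  rw [Finset.card_nbij' (Equiv.swap a b) (Equiv.swap a b)]
  · intro j hj
    simp only [Finset.coe_filter, Set.mem_ofPred_eq] at hj ⊢
    exact ⟨hmem j hj.1, by rw [← hsat, swap_swap_apply]; exact hj.2⟩
  · intro j hj
    simp only [Finset.coe_filter, Set.mem_ofPred_eq] at hj ⊢
    exact ⟨hmem j hj.1, (hsat j).mpr hj.2⟩
  · exact fun j _ => swap_swap_apply a b j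
  · exact fun j _ => swap_swap_apply a b j

lemma exists_swapInvariant (φ : Formula A) : ∃ K, 0 < K ∧ SwapInvariant K φ := by
  induction φ with
  | tru => exact ⟨1, one_pos, fun _ _ _ _ _ _ _ _ _ _ _ _ _ => by simp only [Sat]⟩
  | fls => exact ⟨1, one_pos, fun _ _ _ _ _ _ _ _ _ _ _ _ _ => by simp only [Sat]⟩
  | eq => exact ⟨1, one_pos, fun _ _ _ _ _ _ _ _ _ _ _ _ _ => by simp only [Sat]⟩
  | lt => exact ⟨1, one_pos, fun _ _ _ _ _ _ _ _ _ _ _ _ _ => by simp only [Sat]⟩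
  | qa c p =>
    exact ⟨1, one_pos, fun _ _ _ _ _ _ _ _ _ _ hw ρ _ => by
      simp only [Sat, Function.comp_apply, hw (ρ p)]⟩
  | mod r m p => exact swapInvariant_mod r m p
  | and φ ψ hφ hψ =>
    obtain ⟨K, hK, hφ, hψ⟩ := exists_swapInvariant₂ hφ hψ
    exact ⟨K, hK, fun w w' a b ha hb hab haw hbw hl hw ρ ν =>
      and_congr (hφ w w' a b ha hb hab haw hbw hl hw ρ ν)
        (hψ w w' a b ha hb hab haw hbw hl hw ρ ν)⟩
  | or φ ψ hφ hψ =>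
    obtain ⟨K, hK, hφ, hψ⟩ := exists_swapInvariant₂ hφ hψ
    exact ⟨K, hK, fun w w' a b ha hb hab haw hbw hl hw ρ ν =>
      or_congr (hφ w w' a b ha hb hab haw hbw hl hw ρ ν)
        (hψ w w' a b ha hb hab haw hbw hl hw ρ ν)⟩
  | not φ hφ =>
    obtain ⟨K, hK, hφ⟩ := hφ
    exact ⟨K, hK, fun w w' a b ha hb hab haw hbw hl hw ρ ν =>
      not_congr (hφ w w' a b ha hb hab haw hbw hl hw ρ ν)⟩
  | exC x φ hφ =>
    obtain ⟨K, hK, hφ⟩ := hφ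
    exact ⟨K, hK, fun w w' a b ha hb hab haw hbw hl hw ρ ν =>
      exists_congr fun _ => hφ w w' a b ha hb hab haw hbw hl hw ρ _⟩
  | allC x φ hφ =>
    obtain ⟨K, hK, hφ⟩ := hφ
    exact ⟨K, hK, fun w w' a b ha hb hab haw hbw hl hw ρ ν =>
      forall_congr' fun _ => hφ w w' a b ha hb hab haw hbw hl hw ρ _⟩
  | cnt x p φ hφ =>
    obtain ⟨K, hK, hφ⟩ := hφ
    exact ⟨K, hK, hφ.cnt x p⟩

/-- The sentence `∃x.∃y. (∃^{=x}p. Q₁(p)) ∧ (∃^{=y}p. Q₀(p)) ∧ y < x`. -/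
def majSentence : Formula Bool :=
  .exC 0 (.exC 1 (.and (.cnt 0 0 (.qa true 0)) (.and (.cnt 1 0 (.qa false 0))
    (.lt (.var 1) (.var 0)))))

lemma isSentence_majSentence : IsSentence majSentence := by
  constructor <;> decide

lemma card_positions_eq_count [DecidableEq A] (w : List A) (c : A) :
    ((Finset.Icc 1 w.length).filter (fun j => w[j - 1]? = some c)).card = w.count c := by
  induction w using List.reverseRecOn with
  | nil => simp
  | append_singleton w d ih =>
    rw [List.length_append, List.length_singleton,
      ← Finset.insert_Icc_right_eq_Icc_add_one (by omega), Finset.filter_insert]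
    have hcongr : (Finset.Icc 1 w.length).filter (fun j => (w ++ [d])[j - 1]? = some c) =
        (Finset.Icc 1 w.length).filter (fun j => w[j - 1]? = some c) := by
      refine Finset.filter_congr fun j hj => ?_
      rw [Finset.mem_Icc] at hj
      rw [List.getElem?_append_left (by omega)]
    rw [hcongr, List.count_append, ← ih]
    split_ifs with h
    · rw [Finset.card_insert_of_notMem (by simp)]
      simp_all
    · simp_all

lemma majSentence_defines : Defines majSentence Maj := by
  intro w
  have hcard (c : Bool) (inst : DecidablePred fun j => w[j - 1]? = some c) :
      (@Finset.filter _ (fun j => w[j - 1]? = some c) inst (Finset.Icc 1 w.length)).card =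
        w.count c := by
    rw [← card_positions_eq_count]
    congr
  simp only [majSentence, Sat, CTerm.eval, CTerm.var, Function.update_self, hcard]
  change w.count false < w.count true ↔ _
  simp [Function.update_apply]

end FOC

lemma not_isRegularLang_maj : ¬ IsRegularLang Maj := by
  rintro ⟨Q, _, M, hM⟩
  obtain ⟨i, j, hij, he⟩ :=
    Finite.exists_ne_map_eq_of_infinite fun n : ℕ => M.eval (List.replicate n false)
  wlog hlt : i < j generalizing i j
  · exact this j i hij.symm he.symm (by omega)
  have hi : List.replicate i false ++ List.replicate j true ∈ Maj := by
    simp [Maj, List.count_replicate, hlt]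
  have hj : List.replicate j false ++ List.replicate j true ∉ Maj := by
    simp [Maj, List.count_replicate]
  rw [← hM, DFA.mem_accepts, DFA.eval, DFA.evalFrom_of_append] at hi hj
  exact hj ((congrArg (fun s => M.evalFrom s (List.replicate j true) ∈ M.accept) he).mp hi)

/-- The automaton for `0*1*`: state `0` reads zeros, state `1` reads ones, state `2` rejects. -/
def zerosOnesDFA : DFA Bool (Fin 3) where
  step s c := match s, c with
    | 0, false => 0
    | 0, true => 1
    | 1, true => 1
    | _, _ => 2
  start := 0
  accept := {0, 1}

lemma zerosOnesDFA_evalFrom_two (w : List Bool) : zerosOnesDFA.evalFrom 2 w = 2 := by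
  induction w with
  | nil => rfl
  | cons c w ih => rw [DFA.evalFrom_cons]; cases c <;> exact ih

lemma zerosOnesDFA_evalFrom_one (w : List Bool) :
    zerosOnesDFA.evalFrom 1 w ∈ zerosOnesDFA.accept ↔ ∃ n, w = List.replicate n true := by
  induction w with
  | nil => exact ⟨fun _ => ⟨0, rfl⟩, fun _ => Or.inr rfl⟩
  | cons c w ih =>
    rw [DFA.evalFrom_cons]
    cases c with
    | false =>
      rw [show zerosOnesDFA.step 1 false = 2 from rfl, zerosOnesDFA_evalFrom_two]
      refine iff_of_false (by simp [zerosOnesDFA]) ?_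
      rintro ⟨_ | n, h⟩ <;> simp [List.replicate_succ] at h
    | true =>
      rw [show zerosOnesDFA.step 1 true = 1 from rfl, ih]
      constructor
      · rintro ⟨n, rfl⟩
        exact ⟨n + 1, rfl⟩
      · rintro ⟨_ | n, h⟩
        · simp at h
        · exact ⟨n, by simpa [List.replicate_succ] using h⟩

lemma zerosOnesDFA_evalFrom_zero (w : List Bool) :
    zerosOnesDFA.evalFrom 0 w ∈ zerosOnesDFA.accept ↔ w ∈ LzsOs := by
  induction w with
  | nil => exact ⟨fun _ => ⟨0, 0, rfl⟩, fun _ => Or.inl rfl⟩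
  | cons c w ih =>
    rw [DFA.evalFrom_cons]
    cases c with
    | false =>
      rw [show zerosOnesDFA.step 0 false = 0 from rfl, ih]
      constructor
      · rintro ⟨m, n, rfl⟩
        exact ⟨m + 1, n, rfl⟩
      · rintro ⟨_ | m, n, h⟩
        · cases n <;> simp [List.replicate_succ] at h
        · exact ⟨m, n, by simpa [List.replicate_succ] using h⟩
    | true =>
      rw [show zerosOnesDFA.step 0 true = 1 from rfl, zerosOnesDFA_evalFrom_one]
      constructor
      · rintro ⟨n, rfl⟩
        exact ⟨0, n + 1, rfl⟩
      · rintro ⟨_ | m, _ | n, h⟩ <;> simp [List.replicate_succ] at h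
        exact ⟨n, h⟩

lemma isRegularLang_lzsOs : IsRegularLang LzsOs :=
  ⟨Fin 3, inferInstance, zerosOnesDFA, zerosOnesDFA_evalFrom_zero⟩

lemma not_defines_lzsOs (σ : FOC.Formula Bool) : ¬ FOC.Defines σ LzsOs := by
  intro hσ
  obtain ⟨K, hK, h⟩ := FOC.exists_swapInvariant σ
  set w := List.replicate (2 * K) false ++ List.replicate K true with hw
  set w' := (w.set (2 * K - 1) true).set (3 * K - 1) false with hw'
  have hlen : w.length = 3 * K := by simp [hw]; omega
  have hget (i : ℕ) (hi : i < 3 * K) : w[i]? = some (decide (2 * K ≤ i)) := by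
    simp only [hw, List.getElem?_append, List.length_replicate, List.getElem?_replicate]
    by_cases h : i < 2 * K
    · simp [h]
    · rw [if_neg h, if_pos (by omega), decide_eq_true (by omega)]
  have hswap (j : ℕ) : w'[Equiv.swap (2 * K) (3 * K) j - 1]? = w[j - 1]? := by
    simp only [hw', List.getElem?_set, List.length_set, hlen]
    by_cases h₁ : j = 2 * K
    · rw [h₁, Equiv.swap_apply_left, if_pos rfl, if_pos (by omega), hget _ (by omega),
        decide_eq_false (by omega)]
    by_cases h₂ : j = 3 * K
    · rw [h₂, Equiv.swap_apply_right, if_neg (by omega), if_pos rfl, if_pos (by omega),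
        hget _ (by omega), decide_eq_true (by omega)]
    rw [Equiv.swap_apply_of_ne_of_ne h₁ h₂]
    split_ifs <;> first | rfl | omega
  have hiff := h w w' (2 * K) (3 * K) (by omega) (by omega)
    (by simp [Nat.ModEq]) (hlen ▸ by omega) hlen.ge (by simp [hw']) hswap (fun _ => 1) (fun _ => 0)
  have hone : Equiv.swap (2 * K) (3 * K) ∘ (fun _ : ℕ => 1) = fun _ => 1 :=
    funext fun _ => Equiv.swap_apply_of_ne_of_ne (x := 1) (by omega) (by omega)
  rw [hone, ← hσ, ← hσ] at hiff
  obtain ⟨m, n, hmn⟩ := hiff.mpr ⟨2 * K, K, rfl⟩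
  have ht : w'[2 * K - 1]? = some true := by
    have := hswap (3 * K)
    rw [Equiv.swap_apply_right, hget _ (by omega)] at this
    rw [this]
    simp
    omega
  have hf : w'[3 * K - 1]? = some false := by
    have := hswap (2 * K)
    rw [Equiv.swap_apply_left, hget _ (by omega)] at this
    rw [this]
    simp
    omega
  rw [hmn, List.getElem?_append, List.length_replicate] at ht hf
  simp only [List.getElem?_replicate] at ht hf
  split_ifs at ht hf <;> simp_all
  omega

/-- **Proposition 13.** FOC[+;MOD] is incomparable with the regular languages:
`MAJORITY` is FOC[+;MOD]-definable but not regular, while `0*1*` is regular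
but not FOC[+;MOD]-definable. -/
theorem foc_incomparable_regular :
    ((∃ σ : FOC.Formula Bool, FOC.IsSentence σ ∧ FOC.Defines σ Maj) ∧
      ¬ IsRegularLang Maj) ∧
    (IsRegularLang LzsOs ∧
      ¬ ∃ σ : FOC.Formula Bool, FOC.IsSentence σ ∧ FOC.Defines σ LzsOs) := by
  exact ⟨⟨⟨FOC.majSentence, FOC.isSentence_majSentence, FOC.majSentence_defines⟩,
    not_isRegularLang_maj⟩, isRegularLang_lzsOs, fun ⟨σ, _, hσ⟩ => not_defines_lzsOs σ hσ⟩
end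

section
/- Every formula of FOC[+;MOD] is equivalent to a formula in which (i) every subformula of the form ∃x.φ has no free position variables, and (ii) in every subformula of the form ∃^{=x} p. φ, the body φ is quantifier-free and its only free variable is p itself. -/
/-- A formula is *clear* if (i) in every subformula `∃x.φ` (count
quantification), `φ` has no free position variables, and (ii) in every
subformula `∃^{=x}p.φ`, the body `φ` is quantifier-free and its only free
variable is `p` itself. -/
def Clear {A : Type} : FOC.Formula A → Prop
  | .and φ ψ => Clear φ ∧ Clear ψ
  | .or φ ψ => Clear φ ∧ Clear ψ
  | .not φ => Clear φ
  | .exC _ φ => Clear φ ∧ FOC.freePos φ = ∅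
  | .allC _ φ => Clear φ
  | .cnt _ p φ => FOC.QFree φ ∧ FOC.freePos φ ⊆ {p} ∧ FOC.freeCount φ = ∅
  | _ => True

namespace FOC

variable {A : Type}

theorem Sat.cnt_congr {φ ψ : Formula A} {w : List A} {ρ ρ' : ℕ → ℕ} {ν ν' : ℕ → ℚ} {x p : ℕ}
    (h : ∀ j, Sat w (Function.update ρ p j) ν φ ↔ Sat w (Function.update ρ' p j) ν' ψ)
    (hx : ν x = ν' x := by rfl) :
    Sat w ρ ν (.cnt x p φ) ↔ Sat w ρ' ν' (.cnt x p ψ) := by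
  classical
  rw [Sat, Sat, Finset.filter_congr fun j _ => h j, hx]

theorem Sat.congr_pos {φ : Formula A} {w : List A} {ρ ρ' : ℕ → ℕ} {ν : ℕ → ℚ}
    (h : ∀ p ∈ freePos φ, ρ p = ρ' p) : Sat w ρ ν φ ↔ Sat w ρ' ν φ := by
  induction φ generalizing ρ ρ' ν with
  | tru | fls | eq | lt => simp only [Sat]
  | qa a p | mod r m p => simp only [Sat, h p (by simp [freePos])]
  | and φ ψ ihφ ihψ | or φ ψ ihφ ihψ =>
    simp only [freePos, Finset.mem_union] at h
    simp only [Sat, ihφ fun p hp => h p (.inl hp), ihψ fun p hp => h p (.inr hp)]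
  | not φ ih => simp only [Sat, ih h]
  | exC x φ ih | allC x φ ih => simp only [Sat, ih h]
  | cnt x p φ ih =>
    refine Sat.cnt_congr fun j => ih fun q hq => ?_
    by_cases hqp : q = p
    · simp [hqp]
    · simpa [hqp] using h q (by simp [freePos, hq, hqp])

theorem CTerm.eval_congr {t : CTerm} {ν ν' : ℕ → ℚ} (h : ∀ x ∈ t.vars, ν x = ν' x) :
    t.eval ν = t.eval ν' := by
  have hmap : (t.coeffs.map fun c => c.1 * ν c.2) = t.coeffs.map fun c => c.1 * ν' c.2 :=
    List.map_congr_left fun c hc => by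
      rw [h c.2 (List.mem_toFinset.2 (List.mem_map_of_mem hc))]
  rw [CTerm.eval, CTerm.eval, hmap]

theorem Sat.congr_count {φ : Formula A} {w : List A} {ρ : ℕ → ℕ} {ν ν' : ℕ → ℚ}
    (h : ∀ x ∈ freeCount φ, ν x = ν' x) : Sat w ρ ν φ ↔ Sat w ρ ν' φ := by
  have update {ψ : Formula A} {x : ℕ} {ν ν' : ℕ → ℚ}
      (h : ∀ y ∈ freeCount ψ \ {x}, ν y = ν' y) (q : ℚ) :
      ∀ y ∈ freeCount ψ, Function.update ν x q y = Function.update ν' x q y := by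
    intro y hy
    by_cases hyx : y = x
    · simp [hyx]
    · simpa [hyx] using h y (by simp [hy, hyx])
  induction φ generalizing ρ ν ν' with
  | tru | fls | qa | mod => simp only [Sat]
  | eq t₁ t₂ | lt t₁ t₂ =>
    simp only [freeCount, Finset.mem_union] at h
    simp only [Sat, CTerm.eval_congr fun x hx => h x (.inl hx),
      CTerm.eval_congr fun x hx => h x (.inr hx)]
  | and φ ψ ihφ ihψ | or φ ψ ihφ ihψ =>
    simp only [freeCount, Finset.mem_union] at h
    simp only [Sat, ihφ fun p hp => h p (.inl hp), ihψ fun p hp => h p (.inr hp)]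
  | not φ ih => simp only [Sat, ih h]
  | exC x φ ih => exact exists_congr fun q => ih (update h q)
  | allC x φ ih => exact forall_congr' fun q => ih (update h q)
  | cnt x p φ ih =>
    simp only [freeCount, Finset.mem_union, Finset.mem_singleton] at h
    exact Sat.cnt_congr (fun j => ih fun y hy => h y (.inl hy)) (h x (.inr rfl))

theorem QFree.clear {φ : Formula A} (h : QFree φ) : Clear φ := by
  induction φ with
  | and φ ψ ihφ ihψ | or φ ψ ihφ ihψ => exact ⟨ihφ h.1, ihψ h.2⟩
  | not φ ih => exact ih h
  | exC | allC | cnt => exact h.elim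
  | _ => trivial

/-- A class of formulas containing the truth constants and closed under Boolean combinations. -/
structure BoolClosed (P : Formula A → Prop) : Prop where
  tru : P .tru
  fls : P .fls
  and {φ ψ : Formula A} : P φ → P ψ → P (.and φ ψ)
  or {φ ψ : Formula A} : P φ → P ψ → P (.or φ ψ)
  not {φ : Formula A} : P φ → P (.not φ)

/-- Quantifier-free formulas without count variables whose position variables lie in `S`. -/
def PosQFree (S : Set ℕ) (φ : Formula A) : Prop :=
  QFree φ ∧ freeCount φ = ∅ ∧ ∀ p ∈ freePos φ, p ∈ S

/-- Clear formulas without free position variables. -/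
def ClearPosClosed (φ : Formula A) : Prop :=
  Clear φ ∧ freePos φ = ∅

theorem posQFree_boolClosed (S : Set ℕ) : BoolClosed (PosQFree (A := A) S) where
  tru := by simp [PosQFree, QFree, freeCount, freePos]
  fls := by simp [PosQFree, QFree, freeCount, freePos]
  and := by
    rintro φ ψ ⟨h₁, h₂, h₃⟩ ⟨k₁, k₂, k₃⟩
    refine ⟨⟨h₁, k₁⟩, by simp [freeCount, h₂, k₂], fun p hp => ?_⟩
    exact (Finset.mem_union.1 hp).elim (h₃ p) (k₃ p)
  or := by
    rintro φ ψ ⟨h₁, h₂, h₃⟩ ⟨k₁, k₂, k₃⟩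
    refine ⟨⟨h₁, k₁⟩, by simp [freeCount, h₂, k₂], fun p hp => ?_⟩
    exact (Finset.mem_union.1 hp).elim (h₃ p) (k₃ p)
  not := id

theorem clearPosClosed_boolClosed : BoolClosed (ClearPosClosed (A := A)) where
  tru := ⟨trivial, rfl⟩
  fls := ⟨trivial, rfl⟩
  and h k := ⟨⟨h.1, k.1⟩, by simp [freePos, h.2, k.2]⟩
  or h k := ⟨⟨h.1, k.1⟩, by simp [freePos, h.2, k.2]⟩
  not h := h

/-- The disjunction of the conjunctions `a ∧ b` over the pairs `(a, b)` in a list. -/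
def disjOfPairs (l : List (Formula A × Formula A)) : Formula A :=
  bigOr (l.map fun c => .and c.1 c.2)

theorem sat_disjOfPairs {l : List (Formula A × Formula A)} {w : List A} {ρ : ℕ → ℕ}
    {ν : ℕ → ℚ} : Sat w ρ ν (disjOfPairs l) ↔ ∃ c ∈ l, Sat w ρ ν c.1 ∧ Sat w ρ ν c.2 := by
  induction l with
  | nil => simp [disjOfPairs, bigOr, Sat]
  | cons c l ih =>
    simp only [disjOfPairs, bigOr] at ih
    simp [disjOfPairs, bigOr, Sat, ih]

/-- `φ` is equivalent to a finite disjunction of conjunctions `a ∧ b` with `P a` and `Q b`. -/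
def Splits (P Q : Formula A → Prop) (φ : Formula A) : Prop :=
  ∃ l : List (Formula A × Formula A),
    (∀ c ∈ l, P c.1 ∧ Q c.2) ∧ FOCEquiv φ (disjOfPairs l)

namespace Splits

variable {P Q : Formula A → Prop} {φ ψ : Formula A}

theorem congr (h : FOCEquiv φ ψ) (hψ : Splits P Q ψ) : Splits P Q φ := by
  obtain ⟨l, hl, e⟩ := hψ
  exact ⟨l, hl, fun w ρ ν => (h w ρ ν).trans (e w ρ ν)⟩

theorem of_left (hQ : BoolClosed Q) (h : P φ) : Splits P Q φ :=
  ⟨[(φ, .tru)], by simpa using ⟨h, hQ.tru⟩, fun w ρ ν => by simp [sat_disjOfPairs, Sat]⟩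

theorem of_right (hP : BoolClosed P) (h : Q φ) : Splits P Q φ :=
  ⟨[(.tru, φ)], by simpa using ⟨hP.tru, h⟩, fun w ρ ν => by simp [sat_disjOfPairs, Sat]⟩

theorem or (hφ : Splits P Q φ) (hψ : Splits P Q ψ) : Splits P Q (.or φ ψ) := by
  obtain ⟨l, hl, e⟩ := hφ
  obtain ⟨m, hm, f⟩ := hψ
  refine ⟨l ++ m, fun c hc => (List.mem_append.1 hc).elim (hl c) (hm c), fun w ρ ν => ?_⟩
  simp only [Sat, e w ρ ν, f w ρ ν, sat_disjOfPairs, List.mem_append, or_and_right, exists_or]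

theorem and (hP : BoolClosed P) (hQ : BoolClosed Q) (hφ : Splits P Q φ)
    (hψ : Splits P Q ψ) : Splits P Q (.and φ ψ) := by
  obtain ⟨l, hl, e⟩ := hφ
  obtain ⟨m, hm, f⟩ := hψ
  refine ⟨l.flatMap fun c => m.map fun d => (.and c.1 d.1, .and c.2 d.2), ?_, fun w ρ ν => ?_⟩
  · simp only [List.mem_flatMap, List.mem_map]
    rintro _ ⟨c, hc, d, hd, rfl⟩
    exact ⟨hP.and (hl c hc).1 (hm d hd).1, hQ.and (hl c hc).2 (hm d hd).2⟩
  · simp only [Sat, e w ρ ν, f w ρ ν, sat_disjOfPairs, List.mem_flatMap, List.mem_map]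
    constructor
    · rintro ⟨⟨c, hc, hc₁, hc₂⟩, d, hd, hd₁, hd₂⟩
      exact ⟨_, ⟨c, hc, d, hd, rfl⟩, ⟨hc₁, hd₁⟩, hc₂, hd₂⟩
    · rintro ⟨_, ⟨c, hc, d, hd, rfl⟩, ⟨hc₁, hd₁⟩, hc₂, hd₂⟩
      exact ⟨⟨c, hc, hc₁, hc₂⟩, d, hd, hd₁, hd₂⟩

theorem not (hP : BoolClosed P) (hQ : BoolClosed Q) (hφ : Splits P Q φ) :
    Splits P Q (.not φ) := by
  obtain ⟨l, hl, e⟩ := hφ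
  refine congr (ψ := .not (disjOfPairs l)) (fun w ρ ν => not_congr (e w ρ ν)) ?_
  clear e
  induction l with
  | nil =>
    refine congr (ψ := .tru) (fun w ρ ν => ?_) (of_left hQ hP.tru)
    simp [Sat, sat_disjOfPairs]
  | cons c l ih =>
    simp only [List.forall_mem_cons] at hl
    refine congr (ψ := .and (.or (.not c.1) (.not c.2)) (.not (disjOfPairs l)))
      (fun w ρ ν => ?_)
      (and hP hQ (or (of_left hQ (hP.not hl.1.1)) (of_right hP (hQ.not hl.1.2))) (ih hl.2))
    simp only [Sat, sat_disjOfPairs, List.exists_mem_cons_iff, not_or, not_and_or]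

/-- Every position-only quantifier-free formula separates the atoms in `p` from the others. -/
theorem of_posQFree (p : ℕ) (h : PosQFree Set.univ φ) :
    Splits (PosQFree {p}) (PosQFree {p}ᶜ) φ := by
  have hP := posQFree_boolClosed (A := A) {p}
  have hQ := posQFree_boolClosed (A := A) {p}ᶜ
  obtain ⟨hq, hc, -⟩ := h
  induction φ with
  | tru => exact of_left hQ hP.tru
  | fls => exact of_left hQ hP.fls
  | qa a q | mod r m q =>
    by_cases hqp : q = p
    · exact of_left hQ (by simp [PosQFree, QFree, freeCount, freePos, hqp])
    · exact of_right hP (by simp [PosQFree, QFree, freeCount, freePos, hqp])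
  | eq | lt =>
    exact of_left hQ ⟨trivial, hc, by simp [freePos]⟩
  | and φ ψ ihφ ihψ =>
    obtain ⟨h₁, h₂⟩ := Finset.union_eq_empty.1 hc
    exact and hP hQ (ihφ hq.1 h₁) (ihψ hq.2 h₂)
  | or φ ψ ihφ ihψ =>
    obtain ⟨h₁, h₂⟩ := Finset.union_eq_empty.1 hc
    exact or (ihφ hq.1 h₁) (ihψ hq.2 h₂)
  | not φ ih => exact not hP hQ (ih hq hc)
  | exC | allC | cnt => exact hq.elim

theorem exC (x : ℕ) (h : Splits (PosQFree Set.univ) ClearPosClosed φ) :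
    Splits (PosQFree Set.univ) ClearPosClosed (.exC x φ) := by
  obtain ⟨l, hl, e⟩ := h
  refine ⟨l.map fun c => (c.1, .exC x c.2), ?_, fun w ρ ν => ?_⟩
  · simp only [List.mem_map]
    rintro _ ⟨c, hc, rfl⟩
    exact ⟨(hl c hc).1, (hl c hc).2, (hl c hc).2.2⟩
  · have key (c) (hc : c ∈ l) (q : ℚ) :
        Sat w ρ (Function.update ν x q) c.1 ↔ Sat w ρ ν c.1 :=
      Sat.congr_count (by simp [(hl c hc).1.2.1])
    simp only [Sat, e w ρ _, sat_disjOfPairs, List.mem_map]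
    constructor
    · rintro ⟨q, c, hc, h₁, h₂⟩
      exact ⟨_, ⟨c, hc, rfl⟩, (key c hc q).1 h₁, q, h₂⟩
    · rintro ⟨_, ⟨c, hc, rfl⟩, h₁, q, h₂⟩
      exact ⟨q, c, hc, (key c hc q).2 h₁, h₂⟩

/-- Counting over `p`, where the conjuncts independent of `p` are pulled out by case distinction. -/
theorem cnt_disjOfPairs (x p : ℕ) (l : List (Formula A × Formula A))
    (hl : ∀ c ∈ l, PosQFree {p} c.1 ∧ p ∉ freePos c.2 ∧
      Splits (PosQFree Set.univ) ClearPosClosed c.2)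
    (θ : Formula A) (hθ : PosQFree {p} θ) :
    Splits (PosQFree Set.univ) ClearPosClosed (.cnt x p (.or θ (disjOfPairs l))) := by
  have hP := posQFree_boolClosed (A := A) Set.univ
  have hQ := clearPosClosed_boolClosed (A := A)
  induction l generalizing θ with
  | nil =>
    refine congr (ψ := .cnt x p θ) (fun w ρ ν => Sat.cnt_congr fun j => ?_) (of_right hP ?_)
    · simp [Sat, sat_disjOfPairs]
    · have hsub : freePos θ ⊆ {p} := fun q hq => Finset.mem_singleton.2 (hθ.2.2 q hq)
      exact ⟨⟨hθ.1, hsub, hθ.2.1⟩, Finset.sdiff_eq_empty_iff_subset.2 hsub⟩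
  | cons c l ih =>
    simp only [List.forall_mem_cons] at hl
    obtain ⟨⟨h₁, h₂, h₃⟩, hl⟩ := hl
    refine congr (ψ := .or (.and c.2 (.cnt x p (.or (.or θ c.1) (disjOfPairs l))))
        (.and (.not c.2) (.cnt x p (.or θ (disjOfPairs l))))) (fun w ρ ν => ?_)
      (or (and hP hQ h₃ (ih hl _ ((posQFree_boolClosed _).or hθ h₁)))
        (and hP hQ (not hP hQ h₃) (ih hl θ hθ)))
    have key (j : ℕ) : Sat w (Function.update ρ p j) ν c.2 ↔ Sat w ρ ν c.2 :=
      Sat.congr_pos fun q hq => Function.update_of_ne (ne_of_mem_of_not_mem hq h₂) _ _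
    by_cases hc : Sat w ρ ν c.2
    · refine (Sat.cnt_congr fun j => ?_).trans
        (show Sat w ρ ν (.cnt x p (.or (.or θ c.1) (disjOfPairs l))) ↔ _ by
          rw [Sat, Sat, Sat]; tauto)
      simp only [Sat, sat_disjOfPairs, List.exists_mem_cons_iff, key]
      tauto
    · refine (Sat.cnt_congr fun j => ?_).trans
        (show Sat w ρ ν (.cnt x p (.or θ (disjOfPairs l))) ↔ _ by
          rw [Sat, Sat, Sat, Sat]; tauto)
      simp only [Sat, sat_disjOfPairs, List.exists_mem_cons_iff, key]
      tauto

/-- A formula splits if it is a disjunction of conjunctions of splitting formulas. -/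
theorem bind {R S : Formula A → Prop} (h : Splits R S φ)
    (hRS : ∀ a b, R a → S b → Splits P Q (.and a b)) (hP : BoolClosed P)
    (hQ : BoolClosed Q) : Splits P Q φ := by
  obtain ⟨l, hl, e⟩ := h
  refine congr e ?_
  clear e
  induction l with
  | nil => exact of_left hQ hP.fls
  | cons c l ih =>
    simp only [List.forall_mem_cons] at hl
    exact or (hRS _ _ hl.1.1 hl.1.2) (ih hl.2)

theorem cnt (x p : ℕ) (h : Splits (PosQFree Set.univ) ClearPosClosed φ) :
    Splits (PosQFree Set.univ) ClearPosClosed (.cnt x p φ) := by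
  have hP := posQFree_boolClosed (A := A) Set.univ
  have hQ := clearPosClosed_boolClosed (A := A)
  obtain ⟨l, hl, e⟩ : Splits (PosQFree {p}) (fun g => p ∉ freePos g ∧
      Splits (PosQFree Set.univ) ClearPosClosed g) φ := by
    refine bind h (fun a b ha hb => ?_) (posQFree_boolClosed _) ?_
    · obtain ⟨m, hm, f⟩ := of_posQFree p ha
      refine ⟨m.map fun d => (d.1, .and d.2 b), ?_, fun w ρ ν => ?_⟩
      · simp only [List.mem_map]
        rintro _ ⟨d, hd, rfl⟩
        obtain ⟨h₁, h₂, h₃, h₄⟩ := hm d hd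
        refine ⟨h₁, ?_, and hP hQ (of_left hQ ⟨h₂, h₃, fun _ _ => trivial⟩) (of_right hP hb)⟩
        simp only [freePos, hb.2, Finset.union_empty]
        exact fun hp => h₄ p hp rfl
      · simp only [Sat, f w ρ ν, sat_disjOfPairs, List.mem_map]
        constructor
        · rintro ⟨⟨d, hd, h₁, h₂⟩, h₃⟩
          exact ⟨_, ⟨d, hd, rfl⟩, h₁, h₂, h₃⟩
        · rintro ⟨_, ⟨d, hd, rfl⟩, h₁, h₂, h₃⟩
          exact ⟨⟨d, hd, h₁, h₂⟩, h₃⟩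
    · exact
      { tru := ⟨by simp [freePos], of_left hQ hP.tru⟩
        fls := ⟨by simp [freePos], of_left hQ hP.fls⟩
        and := fun h k => ⟨by simp [freePos, h.1, k.1], and hP hQ h.2 k.2⟩
        or := fun h k => ⟨by simp [freePos, h.1, k.1], or h.2 k.2⟩
        not := fun h => ⟨h.1, not hP hQ h.2⟩ }
  refine congr (fun w ρ ν => Sat.cnt_congr fun j => ?_)
    (cnt_disjOfPairs x p l hl .fls (posQFree_boolClosed _).fls)
  simp [Sat, e w _ ν]

theorem of_formula (φ : Formula A) : Splits (PosQFree Set.univ) ClearPosClosed φ := by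
  have hP := posQFree_boolClosed (A := A) Set.univ
  have hQ := clearPosClosed_boolClosed (A := A)
  induction φ with
  | tru => exact of_left hQ hP.tru
  | fls => exact of_left hQ hP.fls
  | qa a p | mod r m p => exact of_left hQ ⟨trivial, rfl, fun _ _ => trivial⟩
  | eq | lt => exact of_right hP ⟨trivial, rfl⟩
  | and φ ψ ihφ ihψ => exact and hP hQ ihφ ihψ
  | or φ ψ ihφ ihψ => exact or ihφ ihψ
  | not φ ih => exact not hP hQ ih
  | exC x φ ih => exact exC x ih
  | allC x φ ih =>
    exact congr (fun w ρ ν => by simp [Sat]) (not hP hQ (exC x (not hP hQ ih)))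
  | cnt x p φ ih => exact cnt x p ih

end Splits

end FOC

/-- **Proposition (clearing).** Every formula of FOC[+;MOD] is equivalent to a
clear formula. -/
theorem every_formula_equiv_clear {A : Type} (φ : FOC.Formula A) :
    ∃ φ' : FOC.Formula A, FOC.FOCEquiv φ φ' ∧ Clear φ' := by
  obtain ⟨l, hl, e⟩ := FOC.Splits.of_formula φ
  refine ⟨_, e, ?_⟩
  clear e
  induction l with
  | nil => trivial
  | cons c l ih =>
    simp only [List.forall_mem_cons] at hl
    exact ⟨⟨hl.1.1.1.clear, hl.1.2.1⟩, ih hl.2⟩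
end
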